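/- For all positive integers n and m with 1 ≤ m ≤ n, we have ⌊n/2⌋ ≤ h(n,m) ≤ h(n,1). -/

import Mathlib

/-- The generalized binomial coefficient `C(a,k) = a(a-1)⋯(a-k+1)/k!` for an integer `a`
and natural number `k`, as a rational number. -/
def genChoose (a : ℤ) (k : ℕ) : ℚ :=
  (∏ i ∈ Finset.range k, ((a : ℚ) - i)) / (Nat.factorial k)

/-- `hNM n m` is the maximum of the set of `q ∈ ℕ` with `q ≤ n + m` such that
`C(q-n, 2ℓ) + C(q-m, 2ℓ) ≥ C(q, 2ℓ)` for all integers `ℓ` with `1 ≤ ℓ ≤ ⌊q/2⌋`.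
For `n ≥ m ≥ 1` it equals the Hilbert depth of `S_{n,m}/I_{n,m}`. -/
noncomputable def hNM (n m : ℕ) : ℕ :=
  sSup {q : ℕ | q ≤ n + m ∧ ∀ ℓ : ℕ, 1 ≤ ℓ → ℓ ≤ q / 2 →
    genChoose (q : ℤ) (2 * ℓ) ≤
      genChoose ((q : ℤ) - n) (2 * ℓ) + genChoose ((q : ℤ) - m) (2 * ℓ)}

theorem genChoose_succ (a : ℤ) (k : ℕ) :
    genChoose a (k + 1) * (k + 1) = genChoose a k * (a - k) := by
  have hk : ((k : ℚ) + 1) ≠ 0 := by positivity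
  have hf : (Nat.factorial k : ℚ) ≠ 0 := by positivity
  simp only [genChoose, Finset.prod_range_succ, Nat.factorial_succ, Nat.cast_mul, Nat.cast_succ]
  field_simp

theorem genChoose_natCast (n k : ℕ) : genChoose (n : ℤ) k = n.choose k := by
  induction k with
  | zero => simp [genChoose]
  | succ k ih =>
    have h := genChoose_succ n k
    rw [ih] at h
    have hk : ((k : ℚ) + 1) ≠ 0 := by positivity
    apply mul_right_cancel₀ hk
    rw [h]
    rcases le_or_gt k n with hkn | hkn
    · have := Nat.choose_succ_right_eq n k
      zify [hkn] at this
      exact_mod_cast this.symm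
    · simp [Nat.choose_eq_zero_of_lt hkn, Nat.choose_eq_zero_of_lt (Nat.lt_succ_of_lt hkn)]

/-- Upper negation for even lower index. -/
theorem genChoose_two_mul_of_neg (a : ℤ) (l : ℕ) :
    genChoose a (2 * l) =
      (∏ i ∈ Finset.range (2 * l), (-(a : ℚ) + i)) / (Nat.factorial (2 * l)) := by
  have h : ∀ i ∈ Finset.range (2 * l), (-(a : ℚ) + i) = -((a : ℚ) - i) := fun i _ => by ring
  rw [Finset.prod_congr rfl h, Finset.prod_neg]
  simp [genChoose]

theorem genChoose_two_mul_nonneg (a : ℤ) (l : ℕ) : 0 ≤ genChoose a (2 * l) := by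
  rcases le_total 0 a with ha | ha
  · lift a to ℕ using ha
    rw [genChoose_natCast]
    positivity
  · rw [genChoose_two_mul_of_neg]
    have ha' : (a : ℚ) ≤ 0 := by exact_mod_cast ha
    exact div_nonneg (Finset.prod_nonneg fun i _ => by
      have : (0 : ℚ) ≤ i := by positivity
      linarith) (by positivity)

theorem genChoose_two_mul_anti {a b : ℤ} (hab : a ≤ b) (hb : b ≤ 0) (l : ℕ) :
    genChoose b (2 * l) ≤ genChoose a (2 * l) := by
  rw [genChoose_two_mul_of_neg, genChoose_two_mul_of_neg]
  have hab' : (a : ℚ) ≤ b := by exact_mod_cast hab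
  have hb' : (b : ℚ) ≤ 0 := by exact_mod_cast hb
  gcongr with i
  intro i _
  have : (0 : ℚ) ≤ i := by positivity
  linarith

theorem genChoose_le_genChoose_sub {q n l : ℕ} (hqn : 2 * q ≤ n) (hl : 2 * l ≤ q) :
    genChoose (q : ℤ) (2 * l) ≤ genChoose ((q : ℤ) - n) (2 * l) := by
  rw [genChoose_two_mul_of_neg ((q : ℤ) - n), genChoose]
  have h : (2 * q : ℚ) ≤ n := by exact_mod_cast hqn
  have hlt : ∀ i ∈ Finset.range (2 * l), (i : ℚ) ≤ q := fun i hi => by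
    rw [Finset.mem_range] at hi
    exact_mod_cast (by omega : i ≤ q)
  push_cast
  gcongr with i hi
  · intro i hi
    have := hlt i hi
    linarith
  · have : (0 : ℚ) ≤ i := by positivity
    linarith

theorem sub_mul_genChoose (a : ℤ) (k : ℕ) :
    ((a : ℚ) - k) * genChoose a k = a * genChoose (a - 1) k := by
  induction k with
  | zero => simp [genChoose]
  | succ k ih =>
    have h₁ := genChoose_succ a k
    have h₂ := genChoose_succ (a - 1) k
    have hk : ((k : ℚ) + 1) ≠ 0 := by positivity
    apply mul_right_cancel₀ hk
    push_cast at *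
    linear_combination (a - k - 1 : ℚ) * h₁ - a * h₂ + (a - 1 - k : ℚ) * ih

theorem genChoose_add_two (a : ℤ) (l : ℕ) :
    genChoose a (2 * (l + 1)) * ((2 * l + 1) * (2 * l + 2)) =
      genChoose a (2 * l) * ((a - 2 * l) * (a - 2 * l - 1)) := by
  have h₁ := genChoose_succ a (2 * l)
  have h₂ := genChoose_succ a (2 * l + 1)
  push_cast at h₁ h₂
  rw [show 2 * (l + 1) = 2 * l + 1 + 1 by ring]
  linear_combination (2 * l + 1 : ℚ) * h₂ + (a - (2 * l + 1) : ℚ) * h₁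

theorem genChoose_two (a : ℤ) : genChoose a (2 * 1) * 2 = a * (a - 1) := by
  have h := genChoose_add_two a 0
  simp only [genChoose, mul_zero, Finset.range_zero, Finset.prod_empty, Nat.factorial_zero] at h ⊢
  push_cast at h ⊢
  linarith

/-- The growth factor of `C(-a, 2l)` dominates that of `2l * C(q, 2l)` once `4l + 3 ≥ q`. -/
theorem growth_factor_le {a q l : ℕ} (hl : 1 ≤ l) (ha : q ≤ 2 * a) (hq : q ≤ 4 * l + 3)
    (hlq : 2 * l + 2 ≤ q) :
    ((l : ℚ) + 1) * ((q - 2 * l) * (q - 2 * l - 1)) ≤ l * ((a + 2 * l) * (a + 2 * l + 1)) := by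
  obtain ⟨s, rfl⟩ : ∃ s, q = 2 * l + s + 2 := ⟨q - 2 * l - 2, by omega⟩
  have key : (l + 1) * ((s + 2) * (s + 1)) ≤ l * ((a + 2 * l) * (a + 2 * l + 1)) := by
    rcases le_or_gt (s + 2) (2 * l) with h | h
    · have h₁ : 2 * (s + 2) ≤ a + 2 * l := by omega
      calc (l + 1) * ((s + 2) * (s + 1)) ≤ (l + l) * ((s + 2) * (s + 2)) := by gcongr; omega
        _ ≤ l * ((2 * (s + 2)) * (2 * (s + 2))) := by nlinarith
        _ ≤ _ := by gcongr; omega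
    · have h₁ : s + 2 = 2 * l + 1 ∨ s + 2 = 2 * l + 2 ∨ s + 2 = 2 * l + 3 := by omega
      obtain ⟨j, rfl⟩ : ∃ j, l = j + 1 := ⟨l - 1, by omega⟩
      rcases h₁ with h₁ | h₁ | h₁
      · obtain rfl : s = 2 * j + 1 := by omega
        obtain ⟨b, rfl⟩ : ∃ b, a = 2 * j + 3 + b := ⟨a - 2 * j - 3, by omega⟩
        ring_nf; nlinarith [Nat.zero_le (j * b), Nat.zero_le (j ^ 2 * b), Nat.zero_le (j * b ^ 2)]
      · obtain rfl : s = 2 * j + 2 := by omega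
        obtain ⟨b, rfl⟩ : ∃ b, a = 2 * j + 3 + b := ⟨a - 2 * j - 3, by omega⟩
        ring_nf; nlinarith [Nat.zero_le (j * b), Nat.zero_le (j ^ 2 * b), Nat.zero_le (j * b ^ 2)]
      · obtain rfl : s = 2 * j + 3 := by omega
        obtain ⟨b, rfl⟩ : ∃ b, a = 2 * j + 4 + b := ⟨a - 2 * j - 4, by omega⟩
        ring_nf; nlinarith [Nat.zero_le (j * b), Nat.zero_le (j ^ 2 * b), Nat.zero_le (j * b ^ 2)]
  have key' : ((l : ℚ) + 1) * ((s + 2) * (s + 1)) ≤ l * ((a + 2 * l) * (a + 2 * l + 1)) := by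
    exact_mod_cast key
  push_cast
  convert key' using 2
  ring

theorem two_mul_genChoose_le {q n : ℕ} (hqn : q < n)
    (h : ∀ l : ℕ, 1 ≤ l → l ≤ q / 2 →
      genChoose (q : ℤ) (2 * l) ≤ 2 * genChoose ((q : ℤ) - n) (2 * l))
    (l : ℕ) (hl : 1 ≤ l) (hlq : l ≤ q / 2) :
    2 * l * genChoose (q : ℤ) (2 * l) ≤ q * genChoose ((q : ℤ) - n) (2 * l) := by
  obtain ⟨a, rfl⟩ : ∃ a, n = q + a := ⟨n - q, by omega⟩
  have hsub : (q : ℤ) - (q + a : ℕ) = -(a : ℤ) := by push_cast; ring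
  rw [hsub] at h ⊢
  have h1 : q * (q - 1) ≤ 2 * (a * (a + 1)) := by
    have h' := h 1 le_rfl (by omega)
    have e₁ := genChoose_two (q : ℤ)
    have e₂ := genChoose_two (-(a : ℤ))
    push_cast at e₁ e₂
    have : (q : ℚ) * (q - 1) ≤ 2 * (a * (a + 1)) := by linarith
    zify [(by omega : 1 ≤ q)]
    exact_mod_cast this
  have ha : q ≤ 2 * a := by
    obtain ⟨p, rfl⟩ : ∃ p, q = p + 2 := ⟨q - 2, by omega⟩
    by_contra! hlt
    simp only [show p + 2 - 1 = p + 1 by omega] at h1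
    nlinarith
  induction l, hl using Nat.le_induction with
  | base =>
    rcases le_or_gt 4 q with hq | hq
    · have h' := h 1 le_rfl hlq
      have hq' : (4 : ℚ) ≤ q := by exact_mod_cast hq
      have := genChoose_two_mul_nonneg (-(a : ℤ)) 1
      push_cast
      nlinarith
    · have e₁ := genChoose_two (q : ℤ)
      have e₂ := genChoose_two (-(a : ℤ))
      push_cast at e₁ e₂ ⊢
      have : (2 * (q * (q - 1)) : ℚ) ≤ q * (a * (a + 1)) := by
        have hq3 : q = 2 ∨ q = 3 := by omega
        rcases hq3 with rfl | rfl
        · have : (1 : ℚ) ≤ a := by exact_mod_cast (by omega : 1 ≤ a)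
          push_cast; nlinarith
        · have : (2 : ℚ) ≤ a := by exact_mod_cast (by omega : 2 ≤ a)
          push_cast; nlinarith
      nlinarith
  | succ l hl ih =>
    rcases le_or_gt (4 * (l + 1)) q with hq | hq
    · have h' := h (l + 1) (by omega) hlq
      have hq' : (4 * (l + 1) : ℚ) ≤ q := by exact_mod_cast hq
      have := genChoose_two_mul_nonneg (-(a : ℤ)) (l + 1)
      have hl' : (0 : ℚ) ≤ l := by positivity
      push_cast
      nlinarith
    · have ih := ih (by omega)
      have g := growth_factor_le hl ha (by omega : q ≤ 4 * l + 3) (by omega)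
      have e₁ := genChoose_add_two (q : ℤ) l
      have e₂ := genChoose_add_two (-(a : ℤ)) l
      have hM : (0 : ℚ) < (2 * l + 1) * (2 * l + 2) := by positivity
      have hD := genChoose_two_mul_nonneg (q : ℤ) l
      have hA : (0 : ℚ) ≤ (a + 2 * l) * (a + 2 * l + 1) := by positivity
      have s₁ := mul_le_mul_of_nonneg_right ih hA
      have s₂ := mul_le_mul_of_nonneg_left g hD
      refine le_of_mul_le_mul_right ?_ hM
      push_cast at e₁ e₂ ⊢
      calc _ = 2 * (l + 1) * (genChoose q (2 * l) * ((q - 2 * l) * (q - 2 * l - 1))) := by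
            rw [← e₁]; ring
        _ ≤ q * genChoose (-a) (2 * l) * ((a + 2 * l) * (a + 2 * l + 1)) := by linarith
        _ = _ := by linear_combination -(q : ℚ) * e₂

theorem le_of_genChoose_two_le {n m q : ℕ} (hmn : m ≤ n) (hq : q ≤ n + m)
    (h : genChoose (q : ℤ) (2 * 1) ≤
      genChoose ((q : ℤ) - n) (2 * 1) + genChoose ((q : ℤ) - m) (2 * 1)) : q ≤ n := by
  by_contra! hlt
  obtain ⟨x, rfl⟩ : ∃ x, q = n + x := ⟨q - n, by omega⟩
  obtain ⟨z, rfl⟩ : ∃ z, n = m + z := ⟨n - m, by omega⟩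
  obtain ⟨w, rfl⟩ : ∃ w, m = x + w := ⟨m - x, by omega⟩
  have e₁ := genChoose_two ((x + w + z + x : ℕ) : ℤ)
  have e₂ := genChoose_two (((x + w + z + x : ℕ) : ℤ) - (x + w + z : ℕ))
  have e₃ := genChoose_two (((x + w + z + x : ℕ) : ℤ) - (x + w : ℕ))
  have hx : (1 : ℚ) ≤ x := by exact_mod_cast (by omega : 1 ≤ x)
  have hz : (0 : ℚ) ≤ z := by positivity
  have hw : (0 : ℚ) ≤ w := by positivity
  push_cast at h e₁ e₂ e₃
  nlinarith [mul_nonneg hz hw, mul_nonneg hw hw, mul_nonneg (sub_nonneg.2 hx) hw,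
    mul_nonneg (sub_nonneg.2 hx) hz]

/-- For 1 ≤ m ≤ n, we have ⌊n/2⌋ ≤ h(n,m) ≤ h(n,1). -/
theorem hNM_bounds (n m : ℕ) (hm : 1 ≤ m) (hmn : m ≤ n) :
    n / 2 ≤ hNM n m ∧ hNM n m ≤ hNM n 1 := by
  have bdd : ∀ m : ℕ, BddAbove {q : ℕ | q ≤ n + m ∧ ∀ ℓ : ℕ, 1 ≤ ℓ → ℓ ≤ q / 2 →
      genChoose (q : ℤ) (2 * ℓ) ≤
        genChoose ((q : ℤ) - n) (2 * ℓ) + genChoose ((q : ℤ) - m) (2 * ℓ)} :=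
    fun m => ⟨n + m, fun q hq => hq.1⟩
  have mem : n / 2 ∈ {q : ℕ | q ≤ n + m ∧ ∀ ℓ : ℕ, 1 ≤ ℓ → ℓ ≤ q / 2 →
      genChoose (q : ℤ) (2 * ℓ) ≤
        genChoose ((q : ℤ) - n) (2 * ℓ) + genChoose ((q : ℤ) - m) (2 * ℓ)} := by
    refine ⟨by omega, fun l _ hl => ?_⟩
    have h₁ := genChoose_le_genChoose_sub (q := n / 2) (n := n) (l := l) (by omega) (by omega)
    have h₂ := genChoose_two_mul_nonneg (((n / 2 : ℕ) : ℤ) - m) l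
    linarith
  refine ⟨le_csSup (bdd m) mem, csSup_le_csSup' (bdd 1) ?_⟩
  rintro q ⟨hq, h⟩
  have hqn : q ≤ n := by
    rcases le_or_gt q 1 with h1 | h1
    · omega
    · exact le_of_genChoose_two_le hmn hq (h 1 le_rfl (by omega))
  refine ⟨by omega, fun l hl hlq => ?_⟩
  rcases le_or_gt m q with hmq | hmq
  · have hle : genChoose ((q : ℤ) - m) (2 * l) ≤ genChoose ((q : ℤ) - (1 : ℕ)) (2 * l) := by
      rw [← Nat.cast_sub hmq, ← Nat.cast_sub (hm.trans hmq), genChoose_natCast, genChoose_natCast]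
      exact_mod_cast Nat.choose_le_choose _ (by omega)
    linarith [h l hl hlq]
  · have h2 := two_mul_genChoose_le (hmq.trans_le hmn) (fun l hl hlq => by
      have := genChoose_two_mul_anti (a := (q : ℤ) - n) (b := (q : ℤ) - m)
        (by omega) (by omega) l
      linarith [h l hl hlq]) l hl hlq
    have e := sub_mul_genChoose (q : ℤ) (2 * l)
    have hq0 : (0 : ℚ) < q := by exact_mod_cast (by omega : 0 < q)
    refine le_of_mul_le_mul_left ?_ hq0
    push_cast at e ⊢
    linarith
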